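/- Let C = ⟨(b(x) | 0), (ℓ(x) | a(x))⟩ be a Z₂-double cyclic code with b(x) | x^r−1, a(x) | x^s−1, the subcode {(p(x) | 0) ∈ C} equal to ⟨(b(x) | 0)⟩, and a(x) generating C_s. Let b̄(x) be the monic polynomial dividing x^r−1 such that the subcode {(p(x) | 0) ∈ C^⊥} equals ⟨(b̄(x) | 0)⟩. Then b̄(x) = (x^r−1)/gcd(b(x), ℓ(x))*. -/

import Mathlib

open Polynomial

noncomputable section

/-- The polynomial ring `Z₂[x]`. -/
abbrev Z2P : Type := Polynomial (ZMod 2)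

/-- The quotient ring `Z₂[x]/(x^n - 1)`. -/
abbrev Rq (n : ℕ) : Type := Z2P ⧸ Ideal.span {(X : Z2P) ^ n - 1}

/-- The canonical projection `Z₂[x] → Z₂[x]/(x^n - 1)`. -/
def mkQ (n : ℕ) : Z2P →+* Rq n := Ideal.Quotient.mk _

/-- The element of `Z₂[x]/(x^n − 1)` associated to a vector `v ∈ Z₂^n` via coefficients. -/
def ofVec (n : ℕ) (v : Fin n → ZMod 2) : Rq n :=
  mkQ n (∑ i : Fin n, Polynomial.C (v i) * (X : Z2P) ^ (i : ℕ))

/-- The dual code `C^⊥` of a `Z₂`-double cyclic code `C ⊆ R_{r,s}`, computed with respect to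
the standard inner product on `Z₂^{r+s}` under the coefficient identification
`R_{r,s} ≅ Z₂^r × Z₂^s`. -/
def dualCode (r s : ℕ) (C : Submodule Z2P (Rq r × Rq s)) : Set (Rq r × Rq s) :=
  {c | ∃ w : (Fin r → ZMod 2) × (Fin s → ZMod 2),
        (ofVec r w.1, ofVec s w.2) = c ∧
        ∀ u : (Fin r → ZMod 2) × (Fin s → ZMod 2),
          (ofVec r u.1, ofVec s u.2) ∈ C →
          (∑ i, u.1 i * w.1 i) + (∑ j, u.2 j * w.2 j) = 0}

section CyclicOrthogonality

variable {K : Type*} [Field K]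

theorem monic_X_pow_sub_one {r : ℕ} (hr : 0 < r) : ((X : K[X]) ^ r - 1).Monic := by
  simpa using monic_X_pow_sub_C (1 : K) hr.ne'

theorem natDegree_X_pow_sub_one (r : ℕ) : ((X : K[X]) ^ r - 1).natDegree = r := by
  simpa using natDegree_X_pow_sub_C (n := r) (r := (1 : K))

theorem degree_X_pow_sub_one {r : ℕ} (hr : 0 < r) : ((X : K[X]) ^ r - 1).degree = r := by
  simpa using degree_X_pow_sub_C hr (1 : K)

theorem degree_lt_X_pow_sub_one_iff {r : ℕ} (hr : 0 < r) (p : K[X]) :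
    p.degree < ((X : K[X]) ^ r - 1).degree ↔ p.natDegree < r := by
  rw [degree_X_pow_sub_one hr]
  by_cases hp : p = 0
  · simp [hp, hr]
  · rw [natDegree_lt_iff_degree_lt hp]

theorem natDegree_modByMonic_X_pow_sub_one_lt {r : ℕ} (hr : 0 < r) (p : K[X]) :
    (p %ₘ ((X : K[X]) ^ r - 1)).natDegree < r :=
  (degree_lt_X_pow_sub_one_iff hr _).1 (degree_modByMonic_lt _ (monic_X_pow_sub_one hr))

theorem modByMonic_X_pow_sub_one_eq_self {r : ℕ} (hr : 0 < r) {p : K[X]}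
    (hp : p.natDegree < r) : p %ₘ ((X : K[X]) ^ r - 1) = p :=
  (modByMonic_eq_self_iff (monic_X_pow_sub_one hr)).2
    ((degree_lt_X_pow_sub_one_iff hr p).2 hp)

/-- Reduction modulo `X ^ r - 1` preserves the coefficient of `X ^ (r - 1)` in degree at most
`2 * r - 2`. -/
theorem coeff_modByMonic_X_pow_sub_one {r : ℕ} (hr : 0 < r) {p : K[X]}
    (hp : p.natDegree ≤ (r - 1) + (r - 1)) :
    (p %ₘ ((X : K[X]) ^ r - 1)).coeff (r - 1) = p.coeff (r - 1) := by
  rcases lt_or_ge p.natDegree r with h | h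
  · rw [modByMonic_X_pow_sub_one_eq_self hr h]
  · have hq : (p /ₘ ((X : K[X]) ^ r - 1)).natDegree < r - 1 := by
      rw [natDegree_divByMonic _ (monic_X_pow_sub_one hr), natDegree_X_pow_sub_one]
      omega
    conv_rhs => rw [← modByMonic_add_div p ((X : K[X]) ^ r - 1)]
    rw [coeff_add, sub_mul, one_mul, coeff_sub, coeff_X_pow_mul', if_neg (by omega),
      coeff_eq_zero_of_natDegree_lt hq]
    simp

theorem coeff_mul_reflect (n : ℕ) (u w : K[X]) :
    (u * w.reflect n).coeff n = ∑ i ∈ Finset.range (n + 1), u.coeff i * w.coeff i := by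
  rw [coeff_mul, Finset.Nat.sum_antidiagonal_eq_sum_range_succ
    (fun i j => u.coeff i * (w.reflect n).coeff j)]
  refine Finset.sum_congr rfl fun i hi => ?_
  rw [coeff_reflect, revAt_le (Nat.sub_le _ _),
    Nat.sub_sub_self (Nat.lt_succ_iff.1 (Finset.mem_range.1 hi))]

theorem X_pow_sub_one_dvd_of_coeff_mul_modByMonic {r : ℕ} (hr : 0 < r) {y : K[X]}
    (hy : ∀ p : K[X], ((p * y) %ₘ ((X : K[X]) ^ r - 1)).coeff (r - 1) = 0) :
    (X : K[X]) ^ r - 1 ∣ y := by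
  rw [← modByMonic_eq_zero_iff_dvd (monic_X_pow_sub_one hr)]
  by_contra hne
  set z := y %ₘ ((X : K[X]) ^ r - 1)
  have hdeg : z.natDegree < r := natDegree_modByMonic_X_pow_sub_one_lt hr y
  have hmod : (X ^ (r - 1 - z.natDegree) * y) %ₘ ((X : K[X]) ^ r - 1) =
      X ^ (r - 1 - z.natDegree) * z := by
    rw [← modByMonic_X_pow_sub_one_eq_self hr (p := X ^ (r - 1 - z.natDegree) * z)]
    · refine modByMonic_eq_of_dvd_sub (monic_X_pow_sub_one hr) ?_
      rw [← mul_sub]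
      refine Dvd.dvd.mul_left ?_ _
      rw [dvd_sub_comm]
      exact dvd_modByMonic_sub _ _
    · refine natDegree_mul_le.trans_lt ?_
      rw [natDegree_X_pow]
      omega
  have h := hy (X ^ (r - 1 - z.natDegree))
  rw [hmod, coeff_X_pow_mul', if_pos (Nat.sub_le _ _),
    show r - 1 - (r - 1 - z.natDegree) = z.natDegree by omega] at h
  exact hne (leadingCoeff_eq_zero.1 h)

theorem reverse_dvd_of_dvd_reflect {n : ℕ} {h w : K[X]} (hw : w.natDegree ≤ n)
    (hdvd : h ∣ w.reflect n) : h.reverse ∣ w := by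
  obtain ⟨t, ht⟩ := hdvd
  by_cases h0 : w = 0
  · simp [h0]
  have hne : h * t ≠ 0 := by rwa [← ht, Ne, reflect_eq_zero_iff]
  have hle : (h * t).natDegree ≤ n := ht ▸ natDegree_reflect_le.trans (max_le le_rfl hw)
  rw [natDegree_mul (left_ne_zero_of_mul hne) (right_ne_zero_of_mul hne)] at hle
  rw [← reflect_reflect (N := n) (p := w), ht, show n = h.natDegree + (n - h.natDegree) by omega,
    reflect_mul _ _ le_rfl (by omega)]
  exact dvd_mul_right _ _

theorem dvd_reflect_of_reverse_dvd {n : ℕ} {h w : K[X]} (h0 : h.coeff 0 ≠ 0)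
    (hw : w.natDegree ≤ n) (hdvd : h.reverse ∣ w) : h ∣ w.reflect n := by
  have hrev : h.reverse.reverse = h := by
    rw [reverse, reverse_natDegree, natTrailingDegree_eq_zero_of_constantCoeff_ne_zero h0,
      Nat.sub_zero, reverse, reflect_reflect]
  rw [← hrev]
  exact reverse_dvd_of_dvd_reflect (natDegree_reflect_le.trans (max_le le_rfl hw))
    (by rwa [reflect_reflect])

/-- The orthogonal of the cyclic code generated by a divisor `g` of `X ^ r - 1` is generated by
the reciprocal polynomial of `(X ^ r - 1) / g`. -/
theorem forall_dvd_sum_coeff_mul_eq_zero_iff {r : ℕ} (hr : 0 < r) {g h w : K[X]}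
    (hgh : g * h = X ^ r - 1) (hw : w.natDegree < r) :
    (∀ u : K[X], u.natDegree < r → g ∣ u →
      ∑ i ∈ Finset.range r, u.coeff i * w.coeff i = 0) ↔ h.reverse ∣ w := by
  have hm := monic_X_pow_sub_one (K := K) hr
  have hgh0 : g * h ≠ 0 := hgh ▸ hm.ne_zero
  have hpair (u : K[X]) (hu : u.natDegree < r) :
      ∑ i ∈ Finset.range r, u.coeff i * w.coeff i =
        ((u * w.reflect (r - 1)) %ₘ ((X : K[X]) ^ r - 1)).coeff (r - 1) := by
    have hw' : (w.reflect (r - 1)).natDegree ≤ r - 1 :=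
      natDegree_reflect_le.trans (max_le le_rfl (by omega))
    rw [coeff_modByMonic_X_pow_sub_one hr
      (natDegree_mul_le.trans (add_le_add (by omega) hw')), coeff_mul_reflect,
      Nat.sub_add_cancel hr]
  constructor
  · intro H
    refine reverse_dvd_of_dvd_reflect (n := r - 1) (by omega) ?_
    rw [← mul_dvd_mul_iff_left (left_ne_zero_of_mul hgh0), hgh]
    refine X_pow_sub_one_dvd_of_coeff_mul_modByMonic hr fun p => ?_
    have hu := natDegree_modByMonic_X_pow_sub_one_lt hr (p * g)
    have hdvd : (X : K[X]) ^ r - 1 ∣ p * g - (p * g) %ₘ ((X : K[X]) ^ r - 1) := by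
      rw [dvd_sub_comm]
      exact dvd_modByMonic_sub _ _
    have hg : g ∣ (p * g) %ₘ ((X : K[X]) ^ r - 1) :=
      (dvd_sub_right (dvd_mul_left g p)).1 ((hgh ▸ dvd_mul_right g h : g ∣ _).trans hdvd)
    rw [← H _ hu hg, hpair _ hu, ← mul_assoc]
    congr 1
    refine modByMonic_eq_of_dvd_sub hm ?_
    rw [← sub_mul]
    exact hdvd.mul_right _
  · rintro hdvd u hu ⟨u', rfl⟩
    have h0 : h.coeff 0 ≠ 0 := by
      intro h0
      have := congrArg (fun p => coeff p 0) hgh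
      simp [mul_coeff_zero, h0, hr.ne] at this
    obtain ⟨t, ht⟩ := dvd_reflect_of_reverse_dvd h0 (n := r - 1) (by omega) hdvd
    rw [hpair _ hu, ht, (modByMonic_eq_zero_iff_dvd hm).2, coeff_zero]
    exact ⟨u' * t, by rw [← hgh]; ring⟩

theorem dvd_modByMonic_iff {d m p : K[X]} (hd : d ∣ m) : d ∣ p %ₘ m ↔ d ∣ p :=
  dvd_iff_dvd_of_dvd_sub (hd.trans (dvd_modByMonic_sub p m))

theorem eq_of_monic_of_forall_natDegree_lt_dvd_iff {r : ℕ} (hr : 0 < r) {p q : K[X]}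
    (hp : p.Monic) (hq : q.Monic) (hpr : p ∣ X ^ r - 1) (hqr : q ∣ X ^ r - 1)
    (H : ∀ w : K[X], w.natDegree < r → (p ∣ w ↔ q ∣ w)) : p = q := by
  have hall (w : K[X]) : p ∣ w ↔ q ∣ w := by
    rw [← dvd_modByMonic_iff hpr, ← dvd_modByMonic_iff hqr]
    exact H _ (natDegree_modByMonic_X_pow_sub_one_lt hr w)
  exact eq_of_monic_of_associated hp hq
    (associated_of_dvd_dvd ((hall q).2 dvd_rfl) ((hall p).1 dvd_rfl))

end CyclicOrthogonality

/-- The polynomial whose coefficients are the entries of a vector. -/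
def vecPoly {n : ℕ} (v : Fin n → ZMod 2) : Z2P :=
  ∑ i : Fin n, Polynomial.C (v i) * X ^ (i : ℕ)

theorem ofVec_eq_mkQ_vecPoly {n : ℕ} (v : Fin n → ZMod 2) : ofVec n v = mkQ n (vecPoly v) := rfl

theorem coeff_vecPoly {n : ℕ} (v : Fin n → ZMod 2) (i : Fin n) :
    (vecPoly v).coeff i = v i := by
  simp [vecPoly, finsetSum_coeff, coeff_X_pow, Fin.val_inj]

theorem natDegree_vecPoly_lt {n : ℕ} (hn : 0 < n) (v : Fin n → ZMod 2) :
    (vecPoly v).natDegree < n := by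
  refine (Nat.lt_iff_le_pred hn).2 (natDegree_sum_le_of_forall_le _ _ fun i _ => ?_)
  exact (natDegree_C_mul_X_pow_le _ _).trans (by omega)

theorem vecPoly_coeff {n : ℕ} {p : Z2P} (hp : p.natDegree < n) :
    vecPoly (fun i : Fin n => p.coeff i) = p := by
  conv_rhs => rw [p.as_sum_range_C_mul_X_pow' hp]
  exact Fin.sum_univ_eq_sum_range (fun i => Polynomial.C (p.coeff i) * X ^ i) n

theorem sum_mul_eq_sum_coeff_vecPoly {n : ℕ} (u w : Fin n → ZMod 2) :
    ∑ i, u i * w i =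
      ∑ i ∈ Finset.range n, (vecPoly u).coeff i * (vecPoly w).coeff i := by
  rw [← Fin.sum_univ_eq_sum_range (fun i => (vecPoly u).coeff i * (vecPoly w).coeff i) n]
  simp only [coeff_vecPoly]

theorem mkQ_eq_mkQ_iff {n : ℕ} {p q : Z2P} :
    mkQ n p = mkQ n q ↔ (X : Z2P) ^ n - 1 ∣ p - q :=
  Ideal.Quotient.eq.trans Ideal.mem_span_singleton

theorem smul_mkQ (n : ℕ) (p q : Z2P) : p • mkQ n q = mkQ n (p * q) := rfl

theorem exists_ofVec_eq {n : ℕ} (hn : 0 < n) (x : Rq n) : ∃ v, ofVec n v = x := by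
  obtain ⟨p, rfl⟩ := Ideal.Quotient.mk_surjective x
  refine ⟨fun i => (p %ₘ (X ^ n - 1)).coeff i, ?_⟩
  rw [ofVec_eq_mkQ_vecPoly, vecPoly_coeff (natDegree_modByMonic_X_pow_sub_one_lt hn p)]
  exact mkQ_eq_mkQ_iff.2 (dvd_modByMonic_sub _ _)

theorem ofVec_injective {n : ℕ} (hn : 0 < n) : Function.Injective (ofVec n) := by
  intro v w hvw
  have h : vecPoly v %ₘ (X ^ n - 1) = vecPoly w %ₘ (X ^ n - 1) :=
    modByMonic_eq_of_dvd_sub (monic_X_pow_sub_one hn) (mkQ_eq_mkQ_iff.1 hvw)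
  rw [modByMonic_X_pow_sub_one_eq_self hn (natDegree_vecPoly_lt hn v),
    modByMonic_X_pow_sub_one_eq_self hn (natDegree_vecPoly_lt hn w)] at h
  ext i
  rw [← coeff_vecPoly v, h, coeff_vecPoly]

theorem mkQ_mem_span_iff {r s : ℕ} {p q : Z2P} (hp : p ∣ X ^ r - 1) :
    ((mkQ r q, 0) : Rq r × Rq s) ∈ Submodule.span Z2P {((mkQ r p, 0) : Rq r × Rq s)} ↔
      p ∣ q := by
  simp only [Submodule.mem_span_singleton, Prod.smul_mk, smul_zero, Prod.mk.injEq, and_true,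
    smul_mkQ, mkQ_eq_mkQ_iff]
  constructor
  · rintro ⟨c, hc⟩
    exact (dvd_sub_right (dvd_mul_left p c)).1 (hp.trans hc)
  · rintro ⟨c, rfl⟩
    exact ⟨c, by simp [mul_comm]⟩

theorem mkQ_mem_dualCode_iff {r s : ℕ} (hr : 0 < r) (hs : 0 < s) (C : Submodule Z2P (Rq r × Rq s))
    {w : Z2P} (hw : w.natDegree < r) :
    ((mkQ r w, 0) : Rq r × Rq s) ∈ dualCode r s C ↔
      ∀ u : Z2P, u.natDegree < r → (∃ y, (mkQ r u, y) ∈ C) →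
        ∑ i ∈ Finset.range r, u.coeff i * w.coeff i = 0 := by
  have h_zero : ofVec s 0 = 0 := by simp [ofVec]
  have h_vec : ofVec r (fun i => w.coeff i) = mkQ r w := by
    rw [ofVec_eq_mkQ_vecPoly, vecPoly_coeff hw]
  constructor
  · rintro ⟨⟨w₁, w₂⟩, hw12, H⟩ u hu ⟨y, hy⟩
    simp only [Prod.mk.injEq] at hw12
    obtain rfl := ofVec_injective hr (hw12.1.trans h_vec.symm)
    obtain rfl := ofVec_injective hs (hw12.2.trans h_zero.symm)
    obtain ⟨v, rfl⟩ := exists_ofVec_eq hs y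
    have := H (fun i => u.coeff i, v) (by rwa [ofVec_eq_mkQ_vecPoly, vecPoly_coeff hu])
    simpa [sum_mul_eq_sum_coeff_vecPoly (n := r), vecPoly_coeff hu, vecPoly_coeff hw] using this
  · intro H
    refine ⟨(fun i => w.coeff i, 0), by rw [h_vec, h_zero], fun u hu => ?_⟩
    have := H (vecPoly u.1) (natDegree_vecPoly_lt hr _) ⟨_, hu⟩
    simpa [sum_mul_eq_sum_coeff_vecPoly (n := r), vecPoly_coeff hw] using this

theorem exists_mkQ_mem_span_pair_iff {r s : ℕ} {b l : Z2P} (a : Rq s) (hb : b ∣ X ^ r - 1)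
    (u : Z2P) :
    (∃ y, (mkQ r u, y) ∈ Submodule.span Z2P {((mkQ r b, 0) : Rq r × Rq s), (mkQ r l, a)}) ↔
      gcd b l ∣ u := by
  simp only [Submodule.mem_span_pair, Prod.smul_mk, Prod.mk_add_mk, Prod.mk.injEq, smul_mkQ,
    ← map_add, mkQ_eq_mkQ_iff]
  constructor
  · rintro ⟨y, c, d, h, -⟩
    refine (dvd_sub_right ?_).1 (((gcd_dvd_left b l).trans hb).trans h)
    exact dvd_add ((gcd_dvd_left b l).mul_left c) ((gcd_dvd_right b l).mul_left d)
  · rintro ⟨p, rfl⟩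
    obtain ⟨c, d, hcd⟩ := exists_gcd_eq_mul_add_mul b l
    refine ⟨_, p * c, p * d, ?_, rfl⟩
    rw [hcd, show p * c * b + p * d * l - (b * c + l * d) * p = 0 by ring]
    exact dvd_zero _

theorem monic_of_ne_zero_of_zmod_two {p : Z2P} (hp : p ≠ 0) : p.Monic :=
  (by decide : ∀ x : ZMod 2, x ≠ 0 → x = 1) _ (leadingCoeff_ne_zero.2 hp)

theorem reverse_X_pow_sub_one (r : ℕ) : ((X : Z2P) ^ r - 1).reverse = X ^ r - 1 := by
  have h : ((X : Z2P) ^ r - 1).reflect r = -(X ^ r - 1) := by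
    rw [reflect_sub, reflect_monomial, revAt_le le_rfl, ← C_1, reflect_C]
    simp
  rw [reverse, natDegree_X_pow_sub_one, h, CharTwo.neg_eq]

/-- Let `C = ⟨(b | 0), (ℓ | a)⟩` be a `Z₂`-double cyclic code (with the canonical conditions
on the generators), and let `b̄` be the monic divisor of `x^r−1` such that the subcode
`{(p | 0) ∈ C^⊥}` equals `⟨(b̄ | 0)⟩`. Then `b̄ = (x^r−1)/gcd(b, ℓ)*`. -/
theorem stmt16 (r s : ℕ) (hr : 0 < r) (hs : 0 < s) (b l a bb : Z2P)
    (C : Submodule Z2P (Rq r × Rq s))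
    (hCdef : C = Submodule.span Z2P {((mkQ r b, 0) : Rq r × Rq s), (mkQ r l, mkQ s a)})
    (hb : b ∣ (X : Z2P) ^ r - 1) (ha : a ∣ (X : Z2P) ^ s - 1)
    (hker : C ⊓ LinearMap.ker (LinearMap.snd Z2P (Rq r) (Rq s)) =
      Submodule.span Z2P {((mkQ r b, 0) : Rq r × Rq s)})
    (hCs : Submodule.map (LinearMap.snd Z2P (Rq r) (Rq s)) C =
      Submodule.span Z2P {mkQ s a})
    (hbbmonic : bb.Monic) (hbb : bb ∣ (X : Z2P) ^ r - 1)
    (hkerdual : {c : Rq r × Rq s | c ∈ dualCode r s C ∧ c.2 = 0} =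
      (Submodule.span Z2P {((mkQ r bb, 0) : Rq r × Rq s)} : Set (Rq r × Rq s))) :
    bb = ((X : Z2P) ^ r - 1) / (gcd b l).reverse := by
  obtain ⟨h, hgh⟩ := (gcd_dvd_left b l).trans hb
  have hm := monic_X_pow_sub_one (K := ZMod 2) hr
  have hgh0 : gcd b l * h ≠ 0 := hgh ▸ hm.ne_zero
  have hrev : (gcd b l).reverse * h.reverse = X ^ r - 1 := by
    rw [← reverse_mul_of_domain, ← hgh, reverse_X_pow_sub_one]
  have hrev0 : (gcd b l).reverse * h.reverse ≠ 0 := hrev ▸ hm.ne_zero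
  rw [← hrev, mul_div_cancel_left₀ _ (left_ne_zero_of_mul hrev0)]
  refine eq_of_monic_of_forall_natDegree_lt_dvd_iff hr hbbmonic
    (monic_of_ne_zero_of_zmod_two (right_ne_zero_of_mul hrev0)) hbb (hrev ▸ dvd_mul_left _ _)
    fun w hw => ?_
  rw [← forall_dvd_sum_coeff_mul_eq_zero_iff hr hgh.symm hw, ← mkQ_mem_span_iff (s := s) hbb,
    ← SetLike.mem_coe, ← hkerdual]
  refine (and_iff_left rfl).trans ((mkQ_mem_dualCode_iff hr hs C hw).trans ?_)
  simp only [hCdef, exists_mkQ_mem_span_pair_iff (mkQ s a) hb]
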